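/- Let k ≥ 0 be an integer. For every x ∈ [0,1], (1/2)^{k+1} ≤ ∫_0^1 φ_k(|z−x|) dz ≤ (1/2)^{k−1}. -/

import Mathlib

open MeasureTheory Finset

/-- `φ_k(y) = 1 - y ∑_{j<k} (-ln y)^j / j!` for `y ∈ (0,1]`, and `φ_k(0) = 1`. -/
noncomputable def phiUF (k : ℕ) (y : ℝ) : ℝ :=
  if y = 0 then 1
  else 1 - y * ∑ j ∈ Finset.range k, (-Real.log y) ^ j / (Nat.factorial j)

theorem phiUF_zero_left (y : ℝ) : phiUF 0 y = 1 := by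
  simp [phiUF]

theorem phiUF_succ (k : ℕ) {y : ℝ} (hy : y ≠ 0) :
    phiUF (k + 1) y = phiUF k y - y * ((-Real.log y) ^ k / k.factorial) := by
  simp only [phiUF, if_neg hy, Finset.sum_range_succ]
  ring

theorem phiUF_succ_one (k : ℕ) : phiUF (k + 1) 1 = 0 := by
  simp [phiUF, Finset.sum_range_succ']

theorem measurable_phiUF (k : ℕ) : Measurable (phiUF k) := by
  unfold phiUF
  exact Measurable.ite (measurableSet_singleton 0) measurable_const (by fun_prop)

theorem phiUF_nonneg (k : ℕ) {y : ℝ} (hy : y ∈ Set.Icc (0 : ℝ) 1) : 0 ≤ phiUF k y := by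
  rcases hy.1.eq_or_lt with rfl | h0
  · simp [phiUF]
  · have hsum := Real.sum_le_exp_of_nonneg (neg_nonneg.2 (Real.log_nonpos hy.1 hy.2)) k
    rw [Real.exp_neg, Real.exp_log h0] at hsum
    have hmul := mul_le_mul_of_nonneg_left hsum h0.le
    rw [mul_inv_cancel₀ h0.ne'] at hmul
    rw [phiUF, if_neg h0.ne']
    linarith

theorem phiUF_le_one (k : ℕ) {y : ℝ} (hy : y ∈ Set.Icc (0 : ℝ) 1) : phiUF k y ≤ 1 := by
  unfold phiUF
  split_ifs
  · rfl
  · have hlog : 0 ≤ -Real.log y := neg_nonneg.2 (Real.log_nonpos hy.1 hy.2)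
    have hsum : 0 ≤ ∑ j ∈ Finset.range k, (-Real.log y) ^ j / (Nat.factorial j) :=
      Finset.sum_nonneg fun j _ => by positivity
    linarith [mul_nonneg hy.1 hsum]

theorem intervalIntegrable_phiUF (k : ℕ) {a b : ℝ} (ha : a ∈ Set.Icc (0 : ℝ) 1)
    (hb : b ∈ Set.Icc (0 : ℝ) 1) : IntervalIntegrable (phiUF k) volume a b := by
  have h : IntegrableOn (phiUF k) (Set.Icc 0 1) := by
    refine Measure.integrableOn_of_bounded (M := 1) (by simp)
      (measurable_phiUF k).aestronglyMeasurable ?_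
    filter_upwards [ae_restrict_mem measurableSet_Icc] with y hy
    rw [Real.norm_of_nonneg (phiUF_nonneg k hy)]
    exact phiUF_le_one k hy
  exact (h.mono_set (Set.uIcc_subset_Icc ha hb)).intervalIntegrable

theorem hasDerivAt_phiUF_succ (k : ℕ) {y : ℝ} (hy : 0 < y) :
    HasDerivAt (phiUF (k + 1)) (-((-Real.log y) ^ k / k.factorial)) y := by
  have hne : ∀ᶠ z in nhds y, z ≠ 0 := eventually_ne_nhds hy.ne'
  induction k with
  | zero =>
    have h : HasDerivAt (fun z : ℝ => 1 - z) (-1) y := by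
      simpa using (hasDerivAt_id y).const_sub 1
    refine (h.congr_of_eventuallyEq ?_).congr_deriv (by simp)
    filter_upwards [hne] with z hz
    simp [phiUF, hz]
  | succ k ih =>
    have h := ih.sub ((hasDerivAt_id y).mul
      (((Real.hasDerivAt_log hy.ne').neg.pow (k + 1)).div_const ((k + 1).factorial : ℝ)))
    refine (h.congr_of_eventuallyEq ?_).congr_deriv ?_
    · filter_upwards [hne] with z hz
      simpa using phiUF_succ (k + 1) hz
    · have hk : (k.factorial : ℝ) ≠ 0 := by positivity
      have hk1 : (k : ℝ) + 1 ≠ 0 := by positivity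
      simp [Nat.factorial_succ]
      field_simp
      ring

theorem hasDerivAt_mul_phiUF_succ (k : ℕ) {y : ℝ} (hy : 0 < y) :
    HasDerivAt (fun z => z * phiUF (k + 1) z) (2 * phiUF (k + 1) y - phiUF k y) y := by
  refine ((hasDerivAt_id y).mul (hasDerivAt_phiUF_succ k hy)).congr_deriv ?_
  rw [phiUF_succ k hy.ne']
  simp
  ring

theorem continuousOn_mul_phiUF_succ (k : ℕ) :
    ContinuousOn (fun z => z * phiUF (k + 1) z) (Set.Icc 0 1) := by
  intro y hy
  rcases hy.1.eq_or_lt with rfl | h0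
  · have hid : Filter.Tendsto (fun z : ℝ => z) (nhdsWithin 0 (Set.Icc 0 1)) (nhds 0) :=
      Filter.tendsto_id.mono_left nhdsWithin_le_nhds
    rw [ContinuousWithinAt, zero_mul]
    refine tendsto_of_tendsto_of_tendsto_of_le_of_le' tendsto_const_nhds hid ?_ ?_
    · filter_upwards [self_mem_nhdsWithin] with z hz
      exact mul_nonneg hz.1 (phiUF_nonneg _ hz)
    · filter_upwards [self_mem_nhdsWithin] with z hz
      exact mul_le_of_le_one_right hz.1 (phiUF_le_one _ hz)
  · exact (hasDerivAt_mul_phiUF_succ k h0).continuousAt.continuousWithinAt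

theorem two_mul_integral_phiUF_succ (k : ℕ) {a : ℝ} (ha : a ∈ Set.Icc (0 : ℝ) 1) :
    2 * ∫ y in (0 : ℝ)..a, phiUF (k + 1) y
      = a * phiUF (k + 1) a + ∫ y in (0 : ℝ)..a, phiUF k y := by
  have h0 : (0 : ℝ) ∈ Set.Icc (0 : ℝ) 1 := by simp
  have h1 := (intervalIntegrable_phiUF (k + 1) h0 ha).const_mul 2
  have h2 := intervalIntegrable_phiUF k h0 ha
  have h := intervalIntegral.integral_eq_sub_of_hasDerivAt_of_le ha.1
    ((continuousOn_mul_phiUF_succ k).mono (Set.Icc_subset_Icc_right ha.2))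
    (fun y hy => hasDerivAt_mul_phiUF_succ k hy.1) (h1.sub h2)
  rw [intervalIntegral.integral_sub h1 h2, intervalIntegral.integral_const_mul, zero_mul] at h
  linarith

theorem integral_phiUF_zero_one (k : ℕ) : ∫ y in (0 : ℝ)..1, phiUF k y = (1 / 2) ^ k := by
  induction k with
  | zero => simp [phiUF_zero_left]
  | succ k ih =>
    have h := two_mul_integral_phiUF_succ k (a := 1) (by simp)
    rw [phiUF_succ_one, ih] at h
    rw [pow_succ]
    linarith

theorem mul_half_pow_le_integral_phiUF (k : ℕ) {a : ℝ} (ha : a ∈ Set.Icc (0 : ℝ) 1) :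
    a * (1 / 2) ^ k ≤ ∫ y in (0 : ℝ)..a, phiUF k y := by
  induction k with
  | zero => simp [phiUF_zero_left]
  | succ k ih =>
    have h := two_mul_integral_phiUF_succ k ha
    have hnonneg := mul_nonneg ha.1 (phiUF_nonneg (k + 1) ha)
    rw [pow_succ]
    linarith

theorem integral_phiUF_le_half_pow (k : ℕ) {a : ℝ} (ha : a ∈ Set.Icc (0 : ℝ) 1) :
    ∫ y in (0 : ℝ)..a, phiUF k y ≤ (1 / 2) ^ k := by
  have h0 : (0 : ℝ) ∈ Set.Icc (0 : ℝ) 1 := by simp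
  have h1 : (1 : ℝ) ∈ Set.Icc (0 : ℝ) 1 := by simp
  have hsplit := intervalIntegral.integral_add_adjacent_intervals
    (intervalIntegrable_phiUF k h0 ha) (intervalIntegrable_phiUF k ha h1)
  have hnonneg : 0 ≤ ∫ y in a..1, phiUF k y :=
    intervalIntegral.integral_nonneg ha.2 fun y hy => phiUF_nonneg k ⟨ha.1.trans hy.1, hy.2⟩
  rw [integral_phiUF_zero_one] at hsplit
  linarith

theorem integral_phiUF_abs_sub (k : ℕ) {x : ℝ} (hx : x ∈ Set.Icc (0 : ℝ) 1) :
    ∫ z in (0 : ℝ)..1, phiUF k |z - x|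
      = (∫ y in (0 : ℝ)..x, phiUF k y) + ∫ y in (0 : ℝ)..(1 - x), phiUF k y := by
  have hx' : 1 - x ∈ Set.Icc (0 : ℝ) 1 := ⟨by linarith [hx.2], by linarith [hx.1]⟩
  have h0 : (0 : ℝ) ∈ Set.Icc (0 : ℝ) 1 := by simp
  have hleft : Set.EqOn (fun z => phiUF k (x - z)) (fun z => phiUF k |z - x|) (Set.uIcc 0 x) := by
    intro z hz
    rw [Set.uIcc_of_le hx.1] at hz
    simp only [abs_of_nonpos (sub_nonpos.2 hz.2), neg_sub]
  have hright : Set.EqOn (fun z => phiUF k (z - x)) (fun z => phiUF k |z - x|)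
      (Set.uIcc x 1) := by
    intro z hz
    rw [Set.uIcc_of_le hx.2] at hz
    simp only [abs_of_nonneg (sub_nonneg.2 hz.1)]
  have hl : IntervalIntegrable (fun z => phiUF k |z - x|) volume 0 x := by
    have h := (intervalIntegrable_phiUF k hx h0).comp_sub_left x
    rw [sub_self, sub_zero] at h
    exact h.congr (hleft.mono Set.uIoc_subset_uIcc)
  have hr : IntervalIntegrable (fun z => phiUF k |z - x|) volume x 1 := by
    have h := (intervalIntegrable_phiUF k h0 hx').comp_sub_right x
    rw [zero_add, sub_add_cancel] at h
    exact h.congr (hright.mono Set.uIoc_subset_uIcc)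
  rw [← intervalIntegral.integral_add_adjacent_intervals hl hr,
    ← intervalIntegral.integral_congr hleft, ← intervalIntegral.integral_congr hright,
    intervalIntegral.integral_comp_sub_left (phiUF k),
    intervalIntegral.integral_comp_sub_right (phiUF k), sub_self, sub_zero]

/-- Bounds on the integral of the one-dimensional uniform connection function:
`(1/2)^{k+1} ≤ ∫_0^1 φ_k(|z - x|) dz ≤ (1/2)^{k-1}`. -/
theorem integral_phiUF_bounds (k : ℕ) (x : ℝ) (hx : x ∈ Set.Icc (0 : ℝ) 1) :
    (1 / 2 : ℝ) ^ (k + 1) ≤ (∫ z in (0 : ℝ)..1, phiUF k |z - x|) ∧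
      (∫ z in (0 : ℝ)..1, phiUF k |z - x|) ≤ (1 / 2 : ℝ) ^ ((k : ℤ) - 1) := by
  have hx' : 1 - x ∈ Set.Icc (0 : ℝ) 1 := ⟨by linarith [hx.2], by linarith [hx.1]⟩
  have hpow : (0 : ℝ) < (1 / 2) ^ k := by positivity
  rw [integral_phiUF_abs_sub k hx]
  constructor
  · rw [pow_succ]
    linarith [mul_half_pow_le_integral_phiUF k hx, mul_half_pow_le_integral_phiUF k hx']
  · rw [zpow_sub_one₀ (by norm_num), zpow_natCast]
    norm_num only [inv_div]
    linarith [integral_phiUF_le_half_pow k hx, integral_phiUF_le_half_pow k hx']
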